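/- Let G be a Garside group with Garside element Δ and N = ‖Δ‖, and let G_Δ = G/⟨Δ^{m₀}⟩. Then G_Δ is strongly translation discrete: every non-torsion element of G_Δ has strictly positive translation number with respect to 𝒟̄ ∪ 𝒟̄⁻¹, and for every real number r there are only finitely many conjugacy classes of G_Δ containing an element whose translation number with respect to 𝒟̄ ∪ 𝒟̄⁻¹ is at most r. Moreover, every translation number in G_Δ with respect to 𝒟̄ ∪ 𝒟̄⁻¹ is rational of the form p/q for some integers p, q with 1 ≤ q ≤ N². -/

import Mathlib

open Filter Topology Pointwise

/-- Left divisibility order on a group relative to a submonoid `P` of positive elements: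
`a ≤_L b` iff `a⁻¹ * b ∈ P`. -/
def leL {G : Type*} [Group G] (P : Submonoid G) (a b : G) : Prop := a⁻¹ * b ∈ P

/-- Right divisibility order: `a ≤_R b` iff `b * a⁻¹ ∈ P`. -/
def leR {G : Type*} [Group G] (P : Submonoid G) (a b : G) : Prop := b * a⁻¹ ∈ P

/-- An atom of the positive monoid `P`: a nontrivial element admitting no nontrivial
factorization inside `P`. -/
def IsMonAtom {G : Type*} [Group G] (P : Submonoid G) (a : G) : Prop :=
  a ∈ P ∧ a ≠ 1 ∧ ∀ b c : G, b ∈ P → c ∈ P → a = b * c → b = 1 ∨ c = 1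

/-- `a` can be written as a product of `n` atoms of `P`. -/
def IsAtomProd {G : Type*} [Group G] (P : Submonoid G) (n : ℕ) (a : G) : Prop :=
  ∃ l : List G, l.length = n ∧ (∀ x ∈ l, IsMonAtom P x) ∧ l.prod = a

/-- A Garside structure on a group `G`: `G` is the group of fractions of the positive
monoid `P`, which is a finitely generated atomic monoid (with atomic norm `norm`),
a lattice for both `≤_L` and `≤_R`, equipped with a Garside element `Δ` whose left and
right divisors coincide and generate `P`.  The fields `zinf`, `zsup`, `infs`, `sups`,
`tinf`, `tsup` are the (uniquely determined) invariants
`inf g = max {r : Δ^r ≤_L g}`, `sup g = min {s : g ≤_L Δ^s}`,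
`inf_s g = max {inf h : h ∈ [g]}`, `sup_s g = min {sup h : h ∈ [g]}`,
`t_inf g = lim inf(gⁿ)/n` and `t_sup g = lim sup(gⁿ)/n`,
each given together with its defining specification. -/
structure GarsideGroup (G : Type*) [Group G] where
  P : Submonoid G
  /-- `G` is the group of fractions of `P`. -/
  fraction : ∀ g : G, ∃ a b : G, a ∈ P ∧ b ∈ P ∧ g = a⁻¹ * b
  /-- `P` is finitely generated. -/
  fg : P.FG
  /-- the atomic norm `‖·‖` -/
  norm : G → ℕ
  /-- `P` is atomic: every positive element is a product of atoms and `norm a` is the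
  greatest length of such an expression. -/
  norm_spec : ∀ a ∈ P, IsGreatest {n : ℕ | IsAtomProd P n a} (norm a)
  /-- `(P, ≤_L)` is a lattice: gcd's and lcm's exist. -/
  latticeL : ∀ a ∈ P, ∀ b ∈ P,
    (∃ c ∈ P, leL P c a ∧ leL P c b ∧ ∀ d ∈ P, leL P d a → leL P d b → leL P d c) ∧
    (∃ c ∈ P, leL P a c ∧ leL P b c ∧ ∀ d ∈ P, leL P a d → leL P b d → leL P c d)
  /-- `(P, ≤_R)` is a lattice. -/
  latticeR : ∀ a ∈ P, ∀ b ∈ P,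
    (∃ c ∈ P, leR P c a ∧ leR P c b ∧ ∀ d ∈ P, leR P d a → leR P d b → leR P d c) ∧
    (∃ c ∈ P, leR P a c ∧ leR P b c ∧ ∀ d ∈ P, leR P a d → leR P b d → leR P c d)
  /-- the Garside element -/
  Δ : G
  Δ_mem : Δ ∈ P
  /-- the left and right divisors of `Δ` coincide -/
  Δ_balanced : ∀ a ∈ P, (leL P a Δ ↔ leR P a Δ)
  /-- the simple elements generate `P` -/
  simples_gen : Submonoid.closure {a : G | a ∈ P ∧ leL P a Δ} = P
  /-- `inf g = max {r : ℤ | Δ^r ≤_L g}` -/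
  zinf : G → ℤ
  /-- `sup g = min {s : ℤ | g ≤_L Δ^s}` -/
  zsup : G → ℤ
  zinf_spec : ∀ g : G, IsGreatest {r : ℤ | leL P (Δ ^ r) g} (zinf g)
  zsup_spec : ∀ g : G, IsLeast {s : ℤ | leL P g (Δ ^ s)} (zsup g)
  /-- `inf_s g = max {inf h : h ∈ [g]}` -/
  infs : G → ℤ
  /-- `sup_s g = min {sup h : h ∈ [g]}` -/
  sups : G → ℤ
  infs_spec : ∀ g : G, IsGreatest (Set.range fun h : G => zinf (h⁻¹ * g * h)) (infs g)
  sups_spec : ∀ g : G, IsLeast (Set.range fun h : G => zsup (h⁻¹ * g * h)) (sups g)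
  /-- `t_inf g = lim_{n → ∞} inf(gⁿ)/n` -/
  tinf : G → ℝ
  /-- `t_sup g = lim_{n → ∞} sup(gⁿ)/n` -/
  tsup : G → ℝ
  tinf_spec : ∀ g : G,
    Filter.Tendsto (fun n : ℕ => (zinf (g ^ n) : ℝ) / (n : ℝ)) Filter.atTop (nhds (tinf g))
  tsup_spec : ∀ g : G,
    Filter.Tendsto (fun n : ℕ => (zsup (g ^ n) : ℝ) / (n : ℝ)) Filter.atTop (nhds (tsup g))

namespace GarsideGroup

variable {G : Type*} [Group G] (Γ : GarsideGroup G)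

/-- The set `𝒟` of simple elements. -/
def simples : Set G := {a : G | a ∈ Γ.P ∧ leL Γ.P a Γ.Δ}

/-- `len g = sup g - inf g` -/
def len (g : G) : ℤ := Γ.zsup g - Γ.zinf g

/-- `t_len g = t_sup g - t_inf g` -/
noncomputable def tlen (g : G) : ℝ := Γ.tsup g - Γ.tinf g

/-- `g` is inf-straight if `inf g = t_inf g`. -/
def InfStraight (g : G) : Prop := (Γ.zinf g : ℝ) = Γ.tinf g

/-- `g` is sup-straight if `sup g = t_sup g`. -/
def SupStraight (g : G) : Prop := (Γ.zsup g : ℝ) = Γ.tsup g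

/-- The super summit set `[g]^S`. -/
def superSummit (g : G) : Set G :=
  {h : G | (∃ x : G, x⁻¹ * g * x = h) ∧ Γ.zinf h = Γ.infs g ∧ Γ.zsup h = Γ.sups g}

end GarsideGroup

/-- The shortest length of a word over the alphabet `X` representing `g`. -/
noncomputable def wlen {G : Type*} [Group G] (X : Set G) (g : G) : ℕ :=
  sInf {n : ℕ | ∃ l : List G, l.length = n ∧ (∀ x ∈ l, x ∈ X) ∧ l.prod = g}

section abstractLattice

variable {X : Type*}

/-- join of the first `A+1` points of an orbit -/
def orbJoin [SemilatticeSup X] (f : X → X) (x : X) (A : ℕ) : X :=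
  (Finset.range (A + 1)).sup' ⟨0, by simp⟩ (fun i => f^[i] x)

theorem iter_sup [SemilatticeSup X] (f : X → X) (hf : ∀ a b, f (a ⊔ b) = f a ⊔ f b) (n : ℕ)
    (a b : X) : f^[n] (a ⊔ b) = f^[n] a ⊔ f^[n] b := by
  induction n generalizing a b with
  | zero => rfl
  | succ n ih => simp [Function.iterate_succ_apply, hf, ih]

theorem iter_mono [SemilatticeSup X] (f : X → X) (hf : ∀ a b, f (a ⊔ b) = f a ⊔ f b) (n : ℕ)
    {a b : X} (h : a ≤ b) : f^[n] a ≤ f^[n] b := by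
  have := iter_sup f hf n a b
  rw [sup_eq_right.2 h] at this
  rw [this]; exact le_sup_left

theorem orb_map [SemilatticeSup X] (g : X → X) (hg : ∀ a b, g (a ⊔ b) = g a ⊔ g b)
    (f : X → X) (x : X) (A : ℕ) :
    g (orbJoin f x A) = (Finset.range (A + 1)).sup' ⟨0, by simp⟩ (fun i => g (f^[i] x)) := by
  unfold orbJoin
  exact Finset.apply_sup'_eq_sup'_comp _ g hg

theorem orb_le [SemilatticeSup X] (f : X → X) (x : X) (A i : ℕ) (hi : i ≤ A) :
    f^[i] x ≤ orbJoin f x A :=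
  Finset.le_sup' (fun i => f^[i] x) (by simp; omega)

/-- lower bounds along an orbit -/
theorem orb_lower [SemilatticeSup X] (f E : X → X) (hf : ∀ a b, f (a ⊔ b) = f a ⊔ f b)
    (hE : ∀ a b, E (a ⊔ b) = E a ⊔ E b) (hc : ∀ a, f (E a) = E (f a)) (hle : ∀ a, E a ≤ a)
    (A : ℕ) (x : X) (hx : E x ≤ f^[A + 1] x) (n : ℕ) (hn : n ≤ A + 1) :
    E (orbJoin f x A) ≤ f^[n] (orbJoin f x A) := by
  have hcn : ∀ m a, f^[m] (E a) = E (f^[m] a) := by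
    intro m
    induction m with
    | zero => intro a; rfl
    | succ m ih => intro a; simp [Function.iterate_succ_apply, hc, ih]
  rw [orb_map E hE]
  apply Finset.sup'_le
  intro i hi
  simp only [Finset.mem_range] at hi
  by_cases hin : n ≤ i
  · calc E (f^[i] x) ≤ f^[i] x := hle _
      _ = f^[n] (f^[i - n] x) := by rw [← Function.iterate_add_apply]; congr 2; omega
      _ ≤ _ := iter_mono f hf n (orb_le f x A _ (by omega))
  · calc E (f^[i] x) = f^[i] (E x) := (hcn i x).symm
      _ ≤ f^[i] (f^[A + 1] x) := iter_mono f hf i hx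
      _ = f^[n] (f^[i + (A + 1) - n] x) := by
          rw [← Function.iterate_add_apply, ← Function.iterate_add_apply]
          exact congrArg (fun m => f^[m] x) (by omega)
      _ ≤ _ := iter_mono f hf n (orb_le f x A _ (by omega))

/-- upper bounds along an orbit -/
theorem orb_upper [SemilatticeSup X] (f D : X → X) (hf : ∀ a b, f (a ⊔ b) = f a ⊔ f b)
    (hD : ∀ a b, D (a ⊔ b) = D a ⊔ D b) (hc : ∀ a, f (D a) = D (f a)) (hle : ∀ a, a ≤ D a)
    (A : ℕ) (x : X) (hx : f^[A + 1] x ≤ D x) (n : ℕ) (hn : n ≤ A + 1) :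
    f^[n] (orbJoin f x A) ≤ D (orbJoin f x A) := by
  have hcn : ∀ m a, f^[m] (D a) = D (f^[m] a) := by
    intro m
    induction m with
    | zero => intro a; rfl
    | succ m ih => intro a; simp [Function.iterate_succ_apply, hc, ih]
  have hDm : ∀ {a b}, a ≤ b → D a ≤ D b := fun {a b} h => iter_mono D hD 1 h
  rw [orb_map (f^[n]) (iter_sup f hf n)]
  apply Finset.sup'_le
  intro i hi
  simp only [Finset.mem_range] at hi
  rw [← Function.iterate_add_apply]
  by_cases hin : n + i ≤ A
  · exact (orb_le f x A _ hin).trans (hle _)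
  · calc f^[n + i] x = f^[n + i - (A + 1)] (f^[A + 1] x) := by
          rw [← Function.iterate_add_apply]
          exact congrArg (fun m => f^[m] x) (by omega)
      _ ≤ f^[n + i - (A + 1)] (D x) := iter_mono f hf _ hx
      _ = D (f^[n + i - (A + 1)] x) := hcn _ _
      _ ≤ _ := hDm (orb_le f x A _ (by omega))

/-- simultaneous pre/post fixed point -/
theorem both_fixed [SemilatticeSup X] (p q : X → X) (hp : ∀ a b, p (a ⊔ b) = p a ⊔ p b)
    (hq : ∀ a b, q (a ⊔ b) = q a ⊔ q b) (hc : ∀ a, p (q a) = q (p a)) (x y : X) (hxy : x ≤ y)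
    (hx : x ≤ p x) (hy : q y ≤ y)
    (hK : ∀ z : ℕ → X, Monotone z → (∀ i, x ≤ z i ∧ z i ≤ y) → ∃ k, z (k + 1) = z k) :
    ∃ z, z ≤ p z ∧ q z ≤ z := by
  have hqm : ∀ {a b}, a ≤ b → q a ≤ q b := fun {a b} h => iter_mono q hq 1 h
  let z : ℕ → X := fun n => Nat.rec x (fun _ w => x ⊔ q w) n
  have z0 : z 0 = x := rfl
  have zs : ∀ n, z (n + 1) = x ⊔ q (z n) := fun n => rfl
  have hm : Monotone z := by
    apply monotone_nat_of_le_succ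
    intro n
    induction n with
    | zero => rw [zs, z0]; exact le_sup_left
    | succ n ih => rw [zs (n + 1), zs n]; exact sup_le_sup le_rfl (hqm ih)
  have hb : ∀ i, x ≤ z i ∧ z i ≤ y := by
    intro i
    refine ⟨hm (Nat.zero_le i), ?_⟩
    induction i with
    | zero => exact hxy
    | succ n ih => rw [zs]; exact sup_le hxy ((hqm ih).trans hy)
  have hpz : ∀ i, z i ≤ p (z i) := by
    intro i
    induction i with
    | zero => exact hx
    | succ n ih => rw [zs, hp, hc]; exact sup_le_sup hx (hqm ih)
  obtain ⟨k, hk⟩ := hK z hm hb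
  refine ⟨z k, hpz k, ?_⟩
  have := zs k
  rw [hk] at this
  rw [this]
  conv_lhs => rw [← this]
  exact le_sup_right

/-- chains of meets stabilize -/
theorem chain_stab [Lattice X] (f D : X → X) (hf : ∀ a b, f (a ⊓ b) = f a ⊓ f b)
    (hfs : ∀ a b, f (a ⊔ b) = f a ⊔ f b) (hD : ∀ a b, D (a ⊔ b) = D a ⊔ D b)
    (hc : ∀ a, f (D a) = D (f a)) (h : X) (h1 : h ≤ f h) (h2 : h ≤ D h) (N : ℕ)
    (hK : ∀ z : ℕ → X, Monotone z → (∀ i, h ≤ z i ∧ z i ≤ D h) → ∃ k ≤ N, z (k + 1) = z k)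
    (hN : ∀ n ≤ N, ¬ D h ≤ f^[n] h) (n : ℕ) : ¬ D h ≤ f^[n] h := by
  have hmono : Monotone (fun n => f^[n] h) := by
    apply monotone_nat_of_le_succ
    intro n
    rw [Function.iterate_succ_apply]
    exact iter_mono f hfs n h1
  let u : ℕ → X := fun n => f^[n] h ⊓ D h
  have hu : Monotone u := fun a b hab => inf_le_inf (hmono hab) le_rfl
  obtain ⟨k, hkN, hk⟩ := hK u hu (fun i => ⟨le_inf (hmono (Nat.zero_le i)) h2, inf_le_right⟩)
  have hrec : ∀ i, u (i + 1) = f (u i) ⊓ D h := by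
    intro i
    simp only [u]
    rw [Function.iterate_succ_apply', hf, hc, inf_assoc]
    congr 1
    exact (inf_eq_right.2 (iter_mono D hD 1 h1)).symm
  have hst : ∀ j, u (k + j) = u k := by
    intro j
    induction j with
    | zero => rfl
    | succ j ih => rw [← add_assoc, hrec, ih, ← hrec, hk]
  intro hn
  have hnk : k ≤ n := by
    by_contra hlt
    exact hN n (by omega) hn
  have h3 := hst (n - k)
  rw [show k + (n - k) = n by omega] at h3
  have h4 : u n = D h := inf_eq_right.2 hn
  rw [h4] at h3
  exact hN k hkN (h3.le.trans inf_le_left)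

end abstractLattice

namespace GarsideGroup

section basics

variable {G : Type*} [Group G] (Γ : GarsideGroup G)

theorem norm_add_le {a b : G} (ha : a ∈ Γ.P) (hb : b ∈ Γ.P) :
    Γ.norm a + Γ.norm b ≤ Γ.norm (a * b) := by
  obtain ⟨l, hl, hl2, hl3⟩ := (Γ.norm_spec a ha).1
  obtain ⟨k, hk, hk2, hk3⟩ := (Γ.norm_spec b hb).1
  apply (Γ.norm_spec (a * b) (Γ.P.mul_mem ha hb)).2
  refine ⟨l ++ k, by simp [hl, hk], ?_, by simp [hl3, hk3]⟩
  intro x hx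
  rcases List.mem_append.1 hx with h | h
  · exact hl2 x h
  · exact hk2 x h

theorem norm_pos {a : G} (ha : a ∈ Γ.P) (h1 : a ≠ 1) : 1 ≤ Γ.norm a := by
  obtain ⟨l, hl, hl2, hl3⟩ := (Γ.norm_spec a ha).1
  rcases Nat.eq_zero_or_pos (Γ.norm a) with h | h
  · rw [h, List.length_eq_zero_iff] at hl
    subst hl
    exact absurd hl3.symm (by simpa using h1)
  · exact h

theorem eq_one_of {a : G} (ha : a ∈ Γ.P) (hb : a⁻¹ ∈ Γ.P) : a = 1 := by
  by_contra h
  have h1 := Γ.norm_pos ha h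
  have h2 := Γ.norm_add_le ha hb
  have h3 := Γ.norm_add_le Γ.P.one_mem Γ.P.one_mem
  simp at h2 h3
  omega

theorem norm_one : Γ.norm 1 = 0 := by
  have h3 := Γ.norm_add_le Γ.P.one_mem Γ.P.one_mem
  simp at h3
  exact h3

theorem le_refl (a : G) : leL Γ.P a a := by simp [leL]

theorem le_trans {a b c : G} (h1 : leL Γ.P a b) (h2 : leL Γ.P b c) : leL Γ.P a c := by
  have := Γ.P.mul_mem h1 h2
  simpa [leL, mul_assoc] using this

theorem le_antisymm {a b : G} (h1 : leL Γ.P a b) (h2 : leL Γ.P b a) : a = b := by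
  have := Γ.eq_one_of h1 (by simpa [leL] using h2)
  exact (inv_mul_eq_one.1 this)

theorem mul_le (g : G) {a b : G} : leL Γ.P (g * a) (g * b) ↔ leL Γ.P a b := by
  simp [leL, mul_assoc]

theorem one_le {a : G} : leL Γ.P 1 a ↔ a ∈ Γ.P := by simp [leL]

theorem conj_mem {a : G} (ha : a ∈ Γ.P) : Γ.Δ⁻¹ * a * Γ.Δ ∈ Γ.P := by
  rw [← Γ.simples_gen] at ha
  induction ha using Submonoid.closure_induction with
  | mem a h =>
    obtain ⟨ha, hle⟩ := h
    have hb : a⁻¹ * Γ.Δ ∈ Γ.P := hle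
    have h2 : leR Γ.P (a⁻¹ * Γ.Δ) Γ.Δ := by simpa [leR] using ha
    have h3 := (Γ.Δ_balanced _ hb).2 h2
    simpa [leL, mul_assoc] using h3
  | one => simp
  | mul x y _ _ h1 h2 =>
    have := Γ.P.mul_mem h1 h2
    simpa [mul_assoc] using this

theorem conj_mem' {a : G} (ha : a ∈ Γ.P) : Γ.Δ * a * Γ.Δ⁻¹ ∈ Γ.P := by
  rw [← Γ.simples_gen] at ha
  induction ha using Submonoid.closure_induction with
  | mem a h =>
    obtain ⟨ha, hle⟩ := h
    have hb : Γ.Δ * a⁻¹ ∈ Γ.P := (Γ.Δ_balanced a ha).1 hle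
    have h2 : leL Γ.P (Γ.Δ * a⁻¹) Γ.Δ := by simpa [leL] using ha
    have h3 := (Γ.Δ_balanced _ hb).1 h2
    simpa [leR, mul_assoc] using h3
  | one => simp
  | mul x y _ _ h1 h2 =>
    have := Γ.P.mul_mem h1 h2
    simpa [mul_assoc] using this

theorem conj_zpow_mem (k : ℤ) {a : G} (ha : a ∈ Γ.P) : Γ.Δ ^ (-k) * a * Γ.Δ ^ k ∈ Γ.P := by
  induction k using Int.induction_on with
  | zero => simpa using ha
  | succ k ih =>
    have := Γ.conj_mem ih
    have e : Γ.Δ ^ (-((k : ℤ) + 1)) * a * Γ.Δ ^ ((k : ℤ) + 1) =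
        Γ.Δ⁻¹ * (Γ.Δ ^ (-(k : ℤ)) * a * Γ.Δ ^ (k : ℤ)) * Γ.Δ := by
      rw [zpow_add_one, neg_add, add_comm, zpow_add, zpow_neg_one]; group
    rw [e]; exact this
  | pred k ih =>
    have := Γ.conj_mem' ih
    have e : Γ.Δ ^ (-(-(k : ℤ) - 1)) * a * Γ.Δ ^ (-(k : ℤ) - 1) =
        Γ.Δ * (Γ.Δ ^ (-(-(k : ℤ))) * a * Γ.Δ ^ (-(k : ℤ))) * Γ.Δ⁻¹ := by
      rw [zpow_sub_one, show -(-(k : ℤ) - 1) = 1 + -(-(k : ℤ)) by ring, zpow_add, zpow_one]; group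
    rw [e]; exact this

theorem mulΔ_le (k : ℤ) {a b : G} :
    leL Γ.P (a * Γ.Δ ^ k) (b * Γ.Δ ^ k) ↔ leL Γ.P a b := by
  constructor
  · intro h
    have := Γ.conj_zpow_mem (-k) h
    simpa [leL, mul_assoc] using this
  · intro h
    have := Γ.conj_zpow_mem k h
    simpa [leL, mul_assoc] using this

theorem shift_le (g : G) (k : ℤ) {a b : G} :
    leL Γ.P (g * a * Γ.Δ ^ k) (g * b * Γ.Δ ^ k) ↔ leL Γ.P a b := by
  rw [Γ.mulΔ_le, Γ.mul_le]

theorem zpow_mem {k : ℤ} (hk : 0 ≤ k) : Γ.Δ ^ k ∈ Γ.P := by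
  lift k to ℕ using hk
  rw [zpow_natCast]; exact Γ.P.pow_mem Γ.Δ_mem k

theorem le_mulΔ {k : ℤ} (hk : 0 ≤ k) (a : G) : leL Γ.P a (a * Γ.Δ ^ k) := by
  simpa [leL] using Γ.zpow_mem hk

theorem zpow_le {k l : ℤ} (hk : k ≤ l) : leL Γ.P (Γ.Δ ^ k) (Γ.Δ ^ l) := by
  have := Γ.zpow_mem (sub_nonneg.2 hk)
  rw [leL, ← zpow_neg, ← zpow_add]
  rwa [neg_add_eq_sub]

theorem le_zinf {g : G} {r : ℤ} : leL Γ.P (Γ.Δ ^ r) g ↔ r ≤ Γ.zinf g :=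
  ⟨fun h => (Γ.zinf_spec g).2 h, fun h => Γ.le_trans (Γ.zpow_le h) (Γ.zinf_spec g).1⟩

theorem zsup_le {g : G} {r : ℤ} : leL Γ.P g (Γ.Δ ^ r) ↔ Γ.zsup g ≤ r :=
  ⟨fun h => (Γ.zsup_spec g).2 h, fun h => Γ.le_trans (Γ.zsup_spec g).1 (Γ.zpow_le h)⟩

theorem exists_join (a b : G) : ∃ c, leL Γ.P a c ∧ leL Γ.P b c ∧
    ∀ d, leL Γ.P a d → leL Γ.P b d → leL Γ.P c d := by
  set k := min (Γ.zinf a) (Γ.zinf b)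
  have ha : leL Γ.P (Γ.Δ ^ k) a := Γ.le_zinf.2 (min_le_left _ _)
  have hb : leL Γ.P (Γ.Δ ^ k) b := Γ.le_zinf.2 (min_le_right _ _)
  obtain ⟨c, hc, h1, h2, h3⟩ := (Γ.latticeL _ ha _ hb).2
  have key : ∀ d, leL Γ.P ((Γ.Δ ^ k)⁻¹ * d) ((Γ.Δ ^ k)⁻¹ * (Γ.Δ ^ k * c)) ↔
      leL Γ.P d (Γ.Δ ^ k * c) := fun d => Γ.mul_le _
  refine ⟨Γ.Δ ^ k * c, (key a).1 (by simpa using h1), (key b).1 (by simpa using h2), ?_⟩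
  intro d had hbd
  have := h3 ((Γ.Δ ^ k)⁻¹ * d) (Γ.le_trans ha had) ((Γ.mul_le _).2 had) ((Γ.mul_le _).2 hbd)
  have h4 := (Γ.mul_le (Γ.Δ ^ k)).2 this
  simpa using h4

theorem exists_meet (a b : G) : ∃ c, leL Γ.P c a ∧ leL Γ.P c b ∧
    ∀ d, leL Γ.P d a → leL Γ.P d b → leL Γ.P d c := by
  set k := min (Γ.zinf a) (Γ.zinf b)
  have ha : leL Γ.P (Γ.Δ ^ k) a := Γ.le_zinf.2 (min_le_left _ _)
  have hb : leL Γ.P (Γ.Δ ^ k) b := Γ.le_zinf.2 (min_le_right _ _)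
  obtain ⟨c, hc, h1, h2, h3⟩ := (Γ.latticeL _ ha _ hb).1
  have key : ∀ d, leL Γ.P ((Γ.Δ ^ k)⁻¹ * (Γ.Δ ^ k * c)) ((Γ.Δ ^ k)⁻¹ * d) ↔
      leL Γ.P (Γ.Δ ^ k * c) d := fun d => Γ.mul_le _
  refine ⟨Γ.Δ ^ k * c, (key a).1 (by simpa using h1), (key b).1 (by simpa using h2), ?_⟩
  intro d had hbd
  obtain ⟨e, he1, he2, he3⟩ := Γ.exists_join d (Γ.Δ ^ k)
  have hea := he3 a had ha
  have heb := he3 b hbd hb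
  have := h3 ((Γ.Δ ^ k)⁻¹ * e) he2 ((Γ.mul_le _).2 hea) ((Γ.mul_le _).2 heb)
  have h4 := (Γ.mul_le (Γ.Δ ^ k)).2 this
  rw [mul_inv_cancel_left] at h4
  exact Γ.le_trans he1 h4

/-- The lattice structure of `≤_L` on the group. -/
@[reducible] noncomputable def lat : Lattice G where
  le := leL Γ.P
  lt a b := leL Γ.P a b ∧ ¬ leL Γ.P b a
  lt_iff_le_not_ge _ _ := Iff.rfl
  le_refl := Γ.le_refl
  le_trans _ _ _ := Γ.le_trans
  le_antisymm _ _ := Γ.le_antisymm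
  sup a b := Classical.choose (Γ.exists_join a b)
  inf a b := Classical.choose (Γ.exists_meet a b)
  le_sup_left a b := (Classical.choose_spec (Γ.exists_join a b)).1
  le_sup_right a b := (Classical.choose_spec (Γ.exists_join a b)).2.1
  sup_le a b c := (Classical.choose_spec (Γ.exists_join a b)).2.2 c
  inf_le_left a b := (Classical.choose_spec (Γ.exists_meet a b)).1
  inf_le_right a b := (Classical.choose_spec (Γ.exists_meet a b)).2.1
  le_inf a b c := (Classical.choose_spec (Γ.exists_meet b c)).2.2 a

/-- The commuting order automorphisms used below. -/
def shift (g : G) (k : ℤ) (x : G) : G := g * x * Γ.Δ ^ k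

theorem shift_inv (g : G) (k : ℤ) (x : G) : Γ.shift g k (Γ.shift g⁻¹ (-k) x) = x := by
  simp [shift, mul_assoc]

theorem shift_shift (g h : G) (k l : ℤ) (x : G) :
    Γ.shift g k (Γ.shift h l x) = Γ.shift (g * h) (k + l) x := by
  simp only [shift]
  rw [add_comm k l, zpow_add]
  group

theorem shift_iter (g : G) (k : ℤ) (n : ℕ) (x : G) :
    (Γ.shift g k)^[n] x = Γ.shift (g ^ n) (n * k) x := by
  induction n with
  | zero => simp [shift]
  | succ n ih =>
    rw [Function.iterate_succ_apply', ih, shift_shift, pow_succ']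
    congr 1; push_cast; ring

theorem shift_comm {g h : G} (hc : Commute g h) (k l : ℤ) (x : G) :
    Γ.shift g k (Γ.shift h l x) = Γ.shift h l (Γ.shift g k x) := by
  rw [shift_shift, shift_shift, hc.eq, add_comm]

theorem shift_sup (g : G) (k : ℤ) : letI := Γ.lat
    ∀ a b, Γ.shift g k (a ⊔ b) = Γ.shift g k a ⊔ Γ.shift g k b := by
  let _ := Γ.lat
  intro a b
  have hm : ∀ g k {a b : G}, a ≤ b → Γ.shift g k a ≤ Γ.shift g k b :=
    fun g k a b h => (Γ.shift_le g k).2 h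
  apply _root_.le_antisymm
  · have h1 : a ⊔ b ≤ Γ.shift g⁻¹ (-k) (Γ.shift g k a ⊔ Γ.shift g k b) := by
      apply sup_le
      · have := hm g⁻¹ (-k) (le_sup_left : Γ.shift g k a ≤ Γ.shift g k a ⊔ Γ.shift g k b)
        simpa [shift, mul_assoc] using this
      · have := hm g⁻¹ (-k) (le_sup_right : Γ.shift g k b ≤ Γ.shift g k a ⊔ Γ.shift g k b)
        simpa [shift, mul_assoc] using this
    have := hm g k h1
    rwa [shift_inv] at this
  · exact sup_le (hm g k le_sup_left) (hm g k le_sup_right)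

theorem shift_inf (g : G) (k : ℤ) : letI := Γ.lat
    ∀ a b, Γ.shift g k (a ⊓ b) = Γ.shift g k a ⊓ Γ.shift g k b := by
  let _ := Γ.lat
  intro a b
  have hm : ∀ g k {a b : G}, a ≤ b → Γ.shift g k a ≤ Γ.shift g k b :=
    fun g k a b h => (Γ.shift_le g k).2 h
  apply _root_.le_antisymm
  · exact le_inf (hm g k inf_le_left) (hm g k inf_le_right)
  · have h1 : Γ.shift g⁻¹ (-k) (Γ.shift g k a ⊓ Γ.shift g k b) ≤ a ⊓ b := by
      apply le_inf
      · have := hm g⁻¹ (-k) (inf_le_left : Γ.shift g k a ⊓ Γ.shift g k b ≤ Γ.shift g k a)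
        simpa [shift, mul_assoc] using this
      · have := hm g⁻¹ (-k) (inf_le_right : Γ.shift g k a ⊓ Γ.shift g k b ≤ Γ.shift g k b)
        simpa [shift, mul_assoc] using this
    have := hm g k h1
    rwa [shift_inv] at this

/-- chains in intervals are bounded by the norm -/
theorem chain_bound (x b : G) (z : ℕ → G) (hz : ∀ i j, i ≤ j → leL Γ.P (z i) (z j))
    (hb : ∀ i, leL Γ.P x (z i) ∧ leL Γ.P (z i) (x * b)) :
    ∃ k ≤ Γ.norm b, z (k + 1) = z k := by
  by_contra hcon
  push Not at hcon
  have h1 : ∀ k ≤ Γ.norm b + 1, k ≤ Γ.norm (x⁻¹ * z k) := by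
    intro k
    induction k with
    | zero => intro _; omega
    | succ k ih =>
      intro hk
      have h1 := ih (by omega)
      have h2 : leL Γ.P (z k) (z (k + 1)) := hz _ _ (by omega)
      have h3 := Γ.norm_add_le (hb k).1 h2
      have h4 := Γ.norm_pos h2 (fun h => hcon k (by omega) (inv_mul_eq_one.1 h).symm)
      rw [show x⁻¹ * z k * ((z k)⁻¹ * z (k + 1)) = x⁻¹ * z (k + 1) by group] at h3
      omega
  have h2 := h1 _ _root_.le_rfl
  have h3 := Γ.norm_add_le (hb (Γ.norm b + 1)).1 (hb (Γ.norm b + 1)).2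
  rw [show x⁻¹ * z (Γ.norm b + 1) * ((z (Γ.norm b + 1))⁻¹ * (x * b)) = b by group] at h3
  omega

theorem zinf_mul (a b : G) : Γ.zinf a + Γ.zinf b ≤ Γ.zinf (a * b) := by
  rw [← Γ.le_zinf, zpow_add]
  have h1 := (Γ.mulΔ_le (Γ.zinf b)).2 (Γ.zinf_spec a).1
  exact Γ.le_trans h1 ((Γ.mul_le a).2 (Γ.zinf_spec b).1)

theorem zsup_mul (a b : G) : Γ.zsup (a * b) ≤ Γ.zsup a + Γ.zsup b := by
  rw [← Γ.zsup_le, zpow_add]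
  have h1 := (Γ.mulΔ_le (Γ.zsup b)).2 (Γ.zsup_spec a).1
  exact Γ.le_trans ((Γ.mul_le a).2 (Γ.zsup_spec b).1) h1

theorem zsup_inv (a : G) : Γ.zsup a⁻¹ = - Γ.zinf a := by
  have key : ∀ r : ℤ, leL Γ.P a⁻¹ (Γ.Δ ^ r) ↔ leL Γ.P (Γ.Δ ^ (-r)) a := by
    intro r
    rw [← Γ.mulΔ_le (-r), ← Γ.mul_le a]
    have e1 : a * (a⁻¹ * Γ.Δ ^ (-r)) = Γ.Δ ^ (-r) := by group
    have e2 : a * (Γ.Δ ^ r * Γ.Δ ^ (-r)) = a := by rw [← zpow_add]; simp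
    rw [e1, e2]
  apply _root_.le_antisymm
  · rw [← Γ.zsup_le, key, Γ.le_zinf]; simp
  · have := Γ.le_zinf.1 ((key _).1 (Γ.zsup_spec a⁻¹).1)
    omega

theorem zinf_le_zsup (a : G) : Γ.zinf a ≤ Γ.zsup a := by
  by_contra h
  have h1 := Γ.le_trans (Γ.zinf_spec a).1 (Γ.zsup_spec a).1
  have h2 := Γ.zpow_le (le_of_lt (not_le.1 h))
  have h3 := Γ.le_antisymm h1 h2
  have h4 : leL Γ.P (Γ.Δ ^ (Γ.zinf a + (Γ.zinf a - Γ.zsup a))) a := by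
    rw [add_sub, zpow_sub, zpow_add, h3]
    simpa [h3] using (Γ.zinf_spec a).1
  have := Γ.le_zinf.1 h4
  omega

theorem Δ_ne_one : Γ.Δ ≠ 1 := by
  intro h
  have := (Γ.le_zinf (g := 1) (r := Γ.zinf 1 + 1)).1 (by simp [h, leL])
  omega

theorem N_pos : 1 ≤ Γ.norm Γ.Δ := Γ.norm_pos Γ.Δ_mem Γ.Δ_ne_one

theorem zinf_one : Γ.zinf 1 = 0 := by
  apply _root_.le_antisymm
  · by_contra h
    have h1 := (Γ.zinf_spec 1).1
    have h2 : Γ.Δ ^ (1 : ℤ) = 1 := Γ.le_antisymm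
      (Γ.le_trans (Γ.zpow_le (by omega)) h1) (by simpa [leL] using Γ.Δ_mem)
    exact Γ.Δ_ne_one (by simpa using h2)
  · rw [← Γ.le_zinf]; simpa using Γ.le_refl 1

end basics

end GarsideGroup

namespace GarsideGroup

section dynamics

variable {G : Type*} [Group G] (Γ : GarsideGroup G)

theorem le_shift_iff {x y g : G} {k : ℤ} :
    leL Γ.P x (Γ.shift g (-k) y) ↔ leL Γ.P (x * Γ.Δ ^ k) (g * y) := by
  rw [← Γ.mulΔ_le k]
  simp [shift, mul_assoc]

theorem shift_le_iff {x y g : G} {k : ℤ} :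
    leL Γ.P (Γ.shift g (-k) y) x ↔ leL Γ.P (g * y) (x * Γ.Δ ^ k) := by
  rw [← Γ.mulΔ_le k]
  simp [shift, mul_assoc]

theorem exists_low (g : G) (r : ℤ) (A : ℕ) (h : (A + 1 : ℕ) * r ≤ Γ.zinf (g ^ (A + 1))) :
    ∃ y, leL Γ.P (y * Γ.Δ ^ r) (g * y) := by
  let _ := Γ.lat
  rw [← Γ.le_zinf] at h
  have h2 := orb_lower (Γ.shift g (-r)) id (Γ.shift_sup g (-r)) (fun _ _ => rfl) (fun _ => rfl)
    (fun _ => _root_.le_refl _) A 1 (by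
      rw [Γ.shift_iter]
      change leL Γ.P 1 _
      rw [mul_neg, Γ.le_shift_iff]
      simpa using h) 1 (by omega)
  exact ⟨_, Γ.le_shift_iff.1 h2⟩

theorem exists_high (g : G) (r : ℤ) (A : ℕ) (h : Γ.zsup (g ^ (A + 1)) ≤ (A + 1 : ℕ) * r) :
    ∃ y, leL Γ.P (g * y) (y * Γ.Δ ^ r) := by
  let _ := Γ.lat
  rw [← Γ.zsup_le] at h
  have h2 := orb_upper (Γ.shift g (-r)) id (Γ.shift_sup g (-r)) (fun _ _ => rfl) (fun _ => rfl)
    (fun _ => _root_.le_refl _) A 1 (by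
      rw [Γ.shift_iter]
      change leL Γ.P _ 1
      rw [mul_neg, Γ.shift_le_iff]
      simpa using h) 1 (by omega)
  exact ⟨_, Γ.shift_le_iff.1 h2⟩

theorem exists_both (g : G) (r s : ℤ) (h1 : ∃ y, leL Γ.P (y * Γ.Δ ^ r) (g * y))
    (h2 : ∃ y, leL Γ.P (g * y) (y * Γ.Δ ^ s)) :
    ∃ y, leL Γ.P (y * Γ.Δ ^ r) (g * y) ∧ leL Γ.P (g * y) (y * Γ.Δ ^ s) := by
  let _ := Γ.lat
  obtain ⟨x, hx⟩ := h1
  obtain ⟨y, hy⟩ := h2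
  -- translate `y` to the top of `x`
  obtain ⟨k, hk⟩ : ∃ k : ℤ, leL Γ.P x (y * Γ.Δ ^ k) := by
    refine ⟨Γ.zsup (y⁻¹ * x), ?_⟩
    have := (Γ.mul_le y).2 (Γ.zsup_spec (y⁻¹ * x)).1
    simpa using this
  obtain ⟨z, hz1, hz2⟩ := both_fixed (Γ.shift g (-r)) (Γ.shift g (-s)) (Γ.shift_sup g (-r))
    (Γ.shift_sup g (-s)) (fun a => Γ.shift_comm (Commute.refl g) _ _ a) x (y * Γ.Δ ^ k) hk
    (Γ.le_shift_iff.2 hx) (by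
      change leL Γ.P _ _
      rw [Γ.shift_le_iff, mul_assoc, ← zpow_add, add_comm, zpow_add, ← mul_assoc, ← mul_assoc,
        Γ.mulΔ_le]
      exact hy) (by
      intro z hz hb
      obtain ⟨k, _, hk⟩ := Γ.chain_bound x (x⁻¹ * (y * Γ.Δ ^ k)) z (fun i j h => hz h)
        (fun i => ⟨(hb i).1, by rw [mul_inv_cancel_left]; exact (hb i).2⟩)
      exact ⟨k, hk⟩)
  exact ⟨z, Γ.le_shift_iff.1 hz1, Γ.shift_le_iff.1 hz2⟩

theorem stab (g : G) (r : ℤ) (h : r ≤ Γ.zinf g)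
    (hN : ∀ n : ℕ, n ≤ Γ.norm Γ.Δ → Γ.zinf (g ^ n) ≤ n * r) (n : ℕ) : Γ.zinf (g ^ n) ≤ n * r := by
  let _ := Γ.lat
  have key : ∀ n : ℕ, Γ.shift 1 1 1 ≤ (Γ.shift g (-r))^[n] 1 ↔ n * r + 1 ≤ Γ.zinf (g ^ n) := by
    intro n
    rw [Γ.shift_iter, ← Γ.le_zinf]
    change leL Γ.P _ _ ↔ _
    rw [mul_neg, Γ.le_shift_iff]
    simp only [shift]
    rw [add_comm, zpow_add]
    simp
  have := chain_stab (Γ.shift g (-r)) (Γ.shift 1 1) (Γ.shift_inf g (-r)) (Γ.shift_sup g (-r))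
    (Γ.shift_sup 1 1) (fun a => Γ.shift_comm (Commute.one_right g) _ _ a) 1
    (Γ.le_shift_iff.2 (by simpa using Γ.le_zinf.2 h)) (by
      change leL Γ.P _ _
      simpa [shift, leL] using Γ.Δ_mem) (Γ.norm Γ.Δ)
    (by
      intro z hz hb
      exact Γ.chain_bound 1 Γ.Δ z (fun i j h => hz h)
        (fun i => ⟨(hb i).1, by
          have h5 : leL Γ.P (z i) (Γ.shift 1 1 1) := (hb i).2
          simpa [shift] using h5⟩))
    (by
      intro n hn
      rw [key]
      have := hN n hn
      omega) n
  rw [key] at this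
  omega

theorem zinf_pow (g : G) (n : ℕ) : n * Γ.zinf g ≤ Γ.zinf (g ^ n) := by
  induction n with
  | zero => simp [Γ.zinf_one]
  | succ n ih =>
    rw [pow_succ]
    have := Γ.zinf_mul (g ^ n) g
    push_cast
    linarith

theorem zinf_le_tinf (g : G) : (Γ.zinf g : ℝ) ≤ Γ.tinf g := by
  apply ge_of_tendsto (Γ.tinf_spec g)
  filter_upwards [Filter.eventually_gt_atTop 0] with n hn
  rw [le_div_iff₀ (by exact_mod_cast hn), mul_comm]
  exact_mod_cast Γ.zinf_pow g n

theorem tinf_pow (g : G) (n : ℕ) (hn : 0 < n) : Γ.tinf (g ^ n) = n * Γ.tinf g := by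
  have h1 := Γ.tinf_spec (g ^ n)
  have h2 : Filter.Tendsto (fun k : ℕ => n * k) Filter.atTop Filter.atTop :=
    Filter.tendsto_id.const_mul_atTop' hn
  have h3 := ((Γ.tinf_spec g).comp h2).const_mul (n : ℝ)
  refine tendsto_nhds_unique h1 (h3.congr ?_)
  intro k
  have hn' : (n : ℝ) ≠ 0 := by positivity
  simp only [Function.comp]
  rw [← pow_mul]
  push_cast
  rcases eq_or_ne (k : ℝ) 0 with hk | hk
  · simp [hk]
  · field_simp

theorem tinf_conj_le (g h : G) : Γ.tinf g ≤ Γ.tinf (h⁻¹ * g * h) := by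
  have h1 := Γ.tinf_spec g
  have h2 := Γ.tinf_spec (h⁻¹ * g * h)
  have h3 : Filter.Tendsto (fun n : ℕ => ((Γ.zinf h⁻¹ + Γ.zinf h : ℤ) : ℝ) / (n : ℝ))
      Filter.atTop (nhds 0) := tendsto_const_div_atTop_nhds_zero_nat _
  have h4 := h1.add h3
  rw [add_zero] at h4
  refine le_of_tendsto_of_tendsto' h4 h2 ?_
  intro n
  rw [← add_div]
  have e : (h⁻¹ * g * h) ^ n = h⁻¹ * g ^ n * h := by
    have := conj_pow (a := h⁻¹) (b := g) (i := n)
    simpa using this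
  have h5 := Γ.zinf_mul (h⁻¹ * g ^ n) h
  have h6 := Γ.zinf_mul h⁻¹ (g ^ n)
  rw [e]
  gcongr
  have : Γ.zinf (g ^ n) + (Γ.zinf h⁻¹ + Γ.zinf h) ≤ Γ.zinf (h⁻¹ * g ^ n * h) := by linarith
  exact_mod_cast this

theorem tinf_conj (g h : G) : Γ.tinf (h⁻¹ * g * h) = Γ.tinf g := by
  apply _root_.le_antisymm _ (Γ.tinf_conj_le g h)
  have := Γ.tinf_conj_le (h⁻¹ * g * h) h⁻¹
  simpa [mul_assoc] using this

theorem tsup_eq (g : G) : Γ.tsup g = - Γ.tinf g⁻¹ := by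
  refine tendsto_nhds_unique (Γ.tsup_spec g) ((Γ.tinf_spec g⁻¹).neg.congr ?_)
  intro n
  have := Γ.zsup_inv (g⁻¹ ^ n)
  rw [inv_pow, inv_inv] at this
  rw [this, inv_pow]
  push_cast
  ring

theorem tsup_pow (g : G) (n : ℕ) (hn : 0 < n) : Γ.tsup (g ^ n) = n * Γ.tsup g := by
  rw [tsup_eq, tsup_eq, ← inv_pow, Γ.tinf_pow _ _ hn]; ring

theorem exists_low' (g : G) (r : ℤ) (hr : (r : ℝ) < Γ.tinf g) :
    ∃ y, leL Γ.P (y * Γ.Δ ^ r) (g * y) := by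
  have h1 := (Γ.tinf_spec g).eventually (eventually_gt_nhds hr)
  obtain ⟨n, hn, hn0⟩ := (h1.and (Filter.eventually_gt_atTop 0)).exists
  obtain ⟨A, rfl⟩ : ∃ A, n = A + 1 := ⟨n - 1, by omega⟩
  apply Γ.exists_low g r A
  rw [lt_div_iff₀ (by exact_mod_cast hn0)] at hn
  have : r * ((A + 1 : ℕ) : ℤ) < Γ.zinf (g ^ (A + 1)) := by exact_mod_cast hn
  linarith

theorem exists_high' (g : G) (r : ℤ) (hr : Γ.tsup g < r) :
    ∃ y, leL Γ.P (g * y) (y * Γ.Δ ^ r) := by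
  have h1 := (Γ.tsup_spec g).eventually (eventually_lt_nhds hr)
  obtain ⟨n, hn, hn0⟩ := (h1.and (Filter.eventually_gt_atTop 0)).exists
  obtain ⟨A, rfl⟩ : ∃ A, n = A + 1 := ⟨n - 1, by omega⟩
  apply Γ.exists_high g r A
  rw [div_lt_iff₀ (by exact_mod_cast hn0)] at hn
  have : Γ.zsup (g ^ (A + 1)) < r * ((A + 1 : ℕ) : ℤ) := by exact_mod_cast hn
  linarith

theorem exists_both' (g : G) (r s : ℤ) (hr : (r : ℝ) < Γ.tinf g) (hs : Γ.tsup g < s) :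
    ∃ y, leL Γ.P (y * Γ.Δ ^ r) (g * y) ∧ leL Γ.P (g * y) (y * Γ.Δ ^ s) :=
  Γ.exists_both g r s (Γ.exists_low' g r hr) (Γ.exists_high' g s hs)

theorem gap (g : G) (r : ℤ) (hr : (r : ℝ) < Γ.tinf g) :
    (r : ℝ) + 1 / (Γ.norm Γ.Δ : ℝ) ≤ Γ.tinf g := by
  have hN : (0 : ℝ) < Γ.norm Γ.Δ := by exact_mod_cast Γ.N_pos
  obtain ⟨y, hy⟩ := Γ.exists_low' g r hr
  by_contra hcon
  push Not at hcon
  have ht := Γ.tinf_conj g y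
  set g' := y⁻¹ * g * y with hg'
  have h1 : r ≤ Γ.zinf g' := by
    rw [← Γ.le_zinf]
    have := (Γ.mul_le y⁻¹).2 hy
    simpa [hg', mul_assoc] using this
  have h2 := Γ.stab g' r h1 (by
    intro n hn
    rcases Nat.eq_zero_or_pos n with h0 | h0
    · subst h0; simp [Γ.zinf_one]
    have h3 := Γ.zinf_le_tinf (g' ^ n)
    rw [Γ.tinf_pow _ _ h0, ht] at h3
    have hn0 : (0 : ℝ) < n := by exact_mod_cast h0
    have h4 : (n : ℝ) * Γ.tinf g < n * (r + 1 / (Γ.norm Γ.Δ : ℝ)) := by gcongr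
    have h5 : (n : ℝ) * (1 / (Γ.norm Γ.Δ : ℝ)) ≤ 1 := by
      rw [mul_one_div, div_le_one hN]; exact_mod_cast hn
    have h6 : (Γ.zinf (g' ^ n) : ℝ) < ((n * r + 1 : ℤ) : ℝ) := by push_cast; linarith
    have h7 : Γ.zinf (g' ^ n) < n * r + 1 := by exact_mod_cast h6
    omega)
  have h3 : Γ.tinf g' ≤ r := by
    apply le_of_tendsto (Γ.tinf_spec g')
    filter_upwards [Filter.eventually_gt_atTop 0] with n hn
    rw [div_le_iff₀ (by exact_mod_cast hn), mul_comm]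
    exact_mod_cast h2 n
  linarith

theorem rational_of_gap (t : ℝ) (N : ℕ) (hN : 1 ≤ N)
    (h : ∀ k : ℕ, 0 < k → ∀ r : ℤ, (r : ℝ) < k * t → (r : ℝ) + 1 / (N : ℝ) ≤ k * t) :
    ∃ p q : ℤ, 1 ≤ q ∧ q ≤ N ∧ t = (p : ℝ) / q := by
  obtain ⟨j, k, hk0, hkN, hjk⟩ := Real.exists_int_int_abs_mul_sub_le t (n := N) (by omega)
  have hN0 : (0 : ℝ) < N := by exact_mod_cast hN
  have hlt : 1 / ((N : ℝ) + 1) < 1 / N := one_div_lt_one_div_of_lt hN0 (by linarith)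
  have hk0' : (0 : ℝ) < k := by exact_mod_cast hk0
  refine ⟨j, k, hk0, hkN, ?_⟩
  rw [eq_div_iff hk0'.ne']
  lift k to ℕ using hk0.le
  rw [abs_le] at hjk
  push_cast at hjk hk0' ⊢
  rcases lt_trichotomy (j : ℝ) (k * t) with hlt' | heq | hgt
  · have := h k (by exact_mod_cast hk0) j hlt'
    linarith
  · linarith
  · exfalso
    set δ : ℝ := j - k * t with hδ
    have hδ0 : 0 < δ := by linarith
    have hδ1 : δ < 1 / N := by linarith
    set l : ℕ := ⌈1 / δ⌉₊ - 1 with hl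
    have hN1 : 1 / (N : ℝ) ≤ 1 := by rw [div_le_one hN0]; exact_mod_cast hN
    have h1δ : 1 < 1 / δ := by rw [lt_div_iff₀ hδ0]; linarith
    have hc1 := Nat.le_ceil (1 / δ)
    have hc2 := Nat.ceil_lt_add_one (by positivity : 0 ≤ 1 / δ)
    have hc3 : 1 < ⌈1 / δ⌉₊ := by exact_mod_cast h1δ.trans_le hc1
    have hlr : (l : ℝ) = ⌈1 / δ⌉₊ - 1 := by rw [hl]; push_cast [Nat.cast_sub hc3.le]; ring
    have h1 : 1 / δ * δ = 1 := by field_simp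
    have ha : (l : ℝ) * δ < 1 := by
      rw [← h1]; apply mul_lt_mul_of_pos_right _ hδ0; linarith
    have hb : 1 ≤ ((l : ℝ) + 1) * δ := by
      have : 1 / δ ≤ (l : ℝ) + 1 := by linarith
      have h2 := mul_le_mul_of_nonneg_right this hδ0.le
      rwa [h1] at h2
    have hkl : ((l * k : ℕ) : ℝ) * t = l * j - l * δ := by rw [hδ]; push_cast; ring
    have := h (l * k) (Nat.mul_pos (by omega) (by exact_mod_cast hk0)) (l * j - 1)
      (by rw [hkl]; push_cast; linarith)
    rw [hkl] at this
    push_cast at this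
    linarith

theorem tinf_rational (g : G) :
    ∃ p q : ℤ, 1 ≤ q ∧ q ≤ Γ.norm Γ.Δ ∧ Γ.tinf g = (p : ℝ) / q := by
  apply rational_of_gap _ _ Γ.N_pos
  intro k hk r hr
  have := Γ.gap (g ^ k) r
  rw [Γ.tinf_pow _ _ hk] at this
  exact this hr

theorem tsup_rational (g : G) :
    ∃ p q : ℤ, 1 ≤ q ∧ q ≤ Γ.norm Γ.Δ ∧ Γ.tsup g = (p : ℝ) / q := by
  obtain ⟨p, q, h1, h2, h3⟩ := Γ.tinf_rational g⁻¹
  refine ⟨-p, q, h1, h2, ?_⟩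
  rw [tsup_eq, h3]; push_cast; ring

end dynamics

end GarsideGroup

namespace GarsideGroup

section final

variable {G : Type*} [Group G] (Γ : GarsideGroup G)

theorem finite_interval (B : ℤ) : {x : G | x ∈ Γ.P ∧ leL Γ.P x (Γ.Δ ^ B)}.Finite := by
  obtain ⟨S, hS⟩ := Γ.fg
  have key : ∀ x ∈ Submonoid.closure (S : Set G), ∃ l : List S,
      (l.map Subtype.val).prod = x ∧ l.length ≤ Γ.norm x := by
    intro x hx
    induction hx using Submonoid.closure_induction_left with
    | one => exact ⟨[], by simp⟩
    | mul_left s hs y hy ih =>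
      obtain ⟨l, hl, hlen⟩ := ih
      by_cases h1 : s = 1
      · subst h1; exact ⟨l, by simpa using hl, by simpa using hlen⟩
      · have hsP : s ∈ Γ.P := by rw [← hS]; exact Submonoid.subset_closure hs
        have h2 := Γ.norm_add_le hsP (hS ▸ hy)
        have h3 := Γ.norm_pos hsP h1
        refine ⟨⟨s, hs⟩ :: l, by rw [List.map_cons, List.prod_cons, hl], ?_⟩
        simp only [List.length_cons]
        omega
  refine ((List.finite_length_le S (Γ.norm (Γ.Δ ^ B))).image
    (fun l => (l.map Subtype.val).prod)).subset ?_
  rintro x ⟨hx, hle⟩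
  obtain ⟨l, hl, hlen⟩ := key x (by rw [hS]; exact hx)
  refine ⟨l, ?_, hl⟩
  have := Γ.norm_add_le hx hle
  rw [mul_inv_cancel_left] at this
  simp only [Set.mem_ofPred_eq]
  omega

theorem finite_interval' (A B : ℤ) :
    {x : G | leL Γ.P (Γ.Δ ^ A) x ∧ leL Γ.P x (Γ.Δ ^ B)}.Finite := by
  refine ((Γ.finite_interval (B - A)).image (fun x => Γ.Δ ^ A * x)).subset ?_
  rintro x ⟨h1, h2⟩
  refine ⟨(Γ.Δ ^ A)⁻¹ * x, ⟨h1, ?_⟩, by simp⟩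
  rw [← Γ.mul_le (Γ.Δ ^ A), ← zpow_add]
  simpa using h2

theorem torsion_of (g : G) (p : ℤ) (h1 : Γ.tinf g = p) (h2 : Γ.tsup g = p) :
    ∃ (n : ℕ) (y : G), 0 < n ∧ g ^ n * y = y * Γ.Δ ^ (n * p) := by
  let _ := Γ.lat
  have hfin := Γ.finite_interval' (-1) 1
  set I := {x : G | leL Γ.P (Γ.Δ ^ (-1 : ℤ)) x ∧ leL Γ.P x (Γ.Δ ^ (1 : ℤ))} with hI
  set A := hfin.toFinset.card with hA
  obtain ⟨x, hx1, hx2⟩ := Γ.exists_both' (g ^ (A + 1)) ((A + 1 : ℕ) * p - 1) ((A + 1 : ℕ) * p + 1)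
    (by rw [Γ.tinf_pow _ _ (by omega), h1]; push_cast; linarith)
    (by rw [Γ.tsup_pow _ _ (by omega), h2]; push_cast; linarith)
  have hlow := orb_lower (Γ.shift g (-p)) (Γ.shift 1 (-1)) (Γ.shift_sup _ _) (Γ.shift_sup _ _)
    (fun a => Γ.shift_comm (Commute.one_right g) _ _ a) (fun a => by
      change leL Γ.P _ _
      rw [Γ.shift_le_iff, one_mul]; exact Γ.le_mulΔ (by norm_num) a) A x (by
      change leL Γ.P _ _
      rw [Γ.shift_iter, mul_neg, Γ.le_shift_iff]
      simp only [shift]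
      rw [one_mul, mul_assoc, ← zpow_add, neg_add_eq_sub]
      exact hx1)
  have hhigh := orb_upper (Γ.shift g (-p)) (Γ.shift 1 1) (Γ.shift_sup _ _) (Γ.shift_sup _ _)
    (fun a => Γ.shift_comm (Commute.one_right g) _ _ a) (fun a => by
      change leL Γ.P _ _
      simp only [shift]
      rw [one_mul]; exact Γ.le_mulΔ (by norm_num) a) A x (by
      change leL Γ.P _ _
      rw [Γ.shift_iter, mul_neg, Γ.shift_le_iff]
      simp only [shift]
      rw [one_mul, mul_assoc, ← zpow_add, add_comm (1 : ℤ)]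
      exact hx2)
  set y := orbJoin (Γ.shift g (-p)) x A with hy
  let F : ℕ → G := fun n => y⁻¹ * (Γ.shift g (-p))^[n] y
  have hF : ∀ n ∈ Finset.range (A + 1), F n ∈ hfin.toFinset := by
    intro n hn
    rw [Finset.mem_range] at hn
    rw [Set.Finite.mem_toFinset]
    have a1 : leL Γ.P _ _ := hlow n (by omega)
    have a2 : leL Γ.P _ _ := hhigh n (by omega)
    constructor
    · have := (Γ.mul_le y⁻¹).2 a1
      simpa [shift] using this
    · have := (Γ.mul_le y⁻¹).2 a2
      simpa [shift] using this
  obtain ⟨n, hn, m, hm, hne, heq⟩ := Finset.exists_ne_map_eq_of_card_lt_of_maps_to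
    (by simp [hA]) hF
  wlog hlt : n < m generalizing n m
  · exact this m hm n hn hne.symm heq.symm (by omega)
  have heq' : (Γ.shift g (-p))^[n] y = (Γ.shift g (-p))^[m] y := mul_left_cancel heq
  obtain ⟨d, rfl⟩ : ∃ d, m = n + d := ⟨m - n, by omega⟩
  refine ⟨d, y, by omega, ?_⟩
  rw [Γ.shift_iter, Γ.shift_iter] at heq'
  simp only [shift] at heq'
  rw [pow_add, mul_assoc, mul_assoc, mul_assoc] at heq'
  have h3 := mul_left_cancel heq'
  push_cast at h3
  rw [show ((n : ℤ) + d) * -p = -(d * p) + n * -p by ring, zpow_add, ← mul_assoc, ← mul_assoc] at h3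
  have h4 := mul_right_cancel h3
  rw [zpow_neg] at h4
  exact (eq_mul_inv_iff_mul_eq.1 h4).symm

theorem prod_simples (l : ℕ) (x : G) (hx : x ∈ Γ.P) (hle : leL Γ.P x (Γ.Δ ^ (l : ℤ))) :
    ∃ w : List G, w.length = l ∧ (∀ s ∈ w, s ∈ Γ.simples) ∧ w.prod = x := by
  induction l generalizing x with
  | zero =>
    have : x = 1 := Γ.eq_one_of hx (by simpa [leL] using hle)
    exact ⟨[], by simp [this]⟩
  | succ l ih =>
    let _ := Γ.lat
    let s := x ⊓ Γ.Δ
    have hs1 : leL Γ.P s x := (inf_le_left : x ⊓ Γ.Δ ≤ x)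
    have hs2 : leL Γ.P s Γ.Δ := (inf_le_right : x ⊓ Γ.Δ ≤ Γ.Δ)
    have hs3 : s ∈ Γ.P := by
      rw [← Γ.one_le]
      exact (le_inf (Γ.one_le.2 hx) (Γ.one_le.2 Γ.Δ_mem) : 1 ≤ x ⊓ Γ.Δ)
    have h4 : leL Γ.P x (Γ.shift 1 l s) := by
      have := Γ.shift_inf 1 l x Γ.Δ
      rw [show Γ.shift 1 l s = _ from this]
      refine (le_inf ?_ ?_ : x ≤ _)
      · change leL Γ.P _ _
        simpa [shift] using Γ.le_mulΔ (k := l) (by positivity) x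
      · change leL Γ.P _ _
        simp only [shift, one_mul]
        rw [← zpow_one_add, add_comm]
        exact_mod_cast hle
    obtain ⟨w, h5, h6, h7⟩ := ih (s⁻¹ * x) hs1 (by
      rw [← Γ.mul_le s]
      simpa [shift] using h4)
    refine ⟨s :: w, by simp [h5], ?_, by simp [h7]⟩
    intro a ha
    rcases List.mem_cons.1 ha with h | h
    · subst h; exact ⟨hs3, hs2⟩
    · exact h6 a h

theorem zinf_zpow_ge (k : ℤ) : k ≤ Γ.zinf (Γ.Δ ^ k) := Γ.le_zinf.1 (Γ.le_refl _)

theorem zsup_zpow_le (k : ℤ) : Γ.zsup (Γ.Δ ^ k) ≤ k := Γ.zsup_le.1 (Γ.le_refl _)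

/-- the generating set of the quotient -/
abbrev gens (m₀ : ℕ) [(Subgroup.zpowers (Γ.Δ ^ m₀)).Normal] :
    Set (G ⧸ Subgroup.zpowers (Γ.Δ ^ m₀)) :=
  (QuotientGroup.mk' (Subgroup.zpowers (Γ.Δ ^ m₀)) '' Γ.simples) ∪
    (QuotientGroup.mk' (Subgroup.zpowers (Γ.Δ ^ m₀)) '' Γ.simples)⁻¹

theorem mk_eq (m₀ : ℕ) [(Subgroup.zpowers (Γ.Δ ^ m₀)).Normal] {a b : G}
    (h : QuotientGroup.mk' (Subgroup.zpowers (Γ.Δ ^ m₀)) a =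
      QuotientGroup.mk' (Subgroup.zpowers (Γ.Δ ^ m₀)) b) :
    ∃ j : ℤ, b = a * Γ.Δ ^ (m₀ * j) := by
  rw [QuotientGroup.mk'_apply, QuotientGroup.mk'_apply, QuotientGroup.eq] at h
  obtain ⟨j, hj⟩ := Subgroup.mem_zpowers_iff.1 h
  refine ⟨j, ?_⟩
  rw [zpow_mul, zpow_natCast, hj]; simp

theorem mk_zpow (m₀ : ℕ) [(Subgroup.zpowers (Γ.Δ ^ m₀)).Normal] (a : G) (j : ℤ) :
    QuotientGroup.mk' (Subgroup.zpowers (Γ.Δ ^ m₀)) (a * Γ.Δ ^ (m₀ * j)) =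
      QuotientGroup.mk' (Subgroup.zpowers (Γ.Δ ^ m₀)) a := by
  symm
  rw [QuotientGroup.mk'_apply, QuotientGroup.mk'_apply, QuotientGroup.eq]
  refine Subgroup.mem_zpowers_iff.2 ⟨j, ?_⟩
  rw [zpow_mul, zpow_natCast]; simp

theorem word_lower (m₀ : ℕ) [(Subgroup.zpowers (Γ.Δ ^ m₀)).Normal]
    (l : List (G ⧸ Subgroup.zpowers (Γ.Δ ^ m₀))) (hl : ∀ x ∈ l, x ∈ Γ.gens m₀) :
    ∃ g, QuotientGroup.mk' (Subgroup.zpowers (Γ.Δ ^ m₀)) g = l.prod ∧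
      Γ.zsup g - Γ.zinf g ≤ l.length := by
  induction l with
  | nil =>
    refine ⟨1, by simp, ?_⟩
    have := Γ.zsup_zpow_le 0
    rw [zpow_zero] at this
    simp [Γ.zinf_one, this]
  | cons x l ih =>
    obtain ⟨g, hg, hlen⟩ := ih (fun y hy => hl y (List.mem_cons_of_mem _ hy))
    have hs : ∀ s ∈ Γ.simples, 0 ≤ Γ.zinf s ∧ Γ.zsup s ≤ 1 := by
      rintro s ⟨h1, h2⟩
      refine ⟨Γ.le_zinf.1 (by simpa [leL] using h1), Γ.zsup_le.1 (by simpa using h2)⟩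
    obtain ⟨s, hsx, hs1⟩ : ∃ s, QuotientGroup.mk' (Subgroup.zpowers (Γ.Δ ^ m₀)) s = x ∧
        Γ.zsup s - Γ.zinf s ≤ 1 := by
      rcases hl x List.mem_cons_self with ⟨s, h1, h2⟩ | ⟨s, h1, h2⟩
      · have := hs s h1
        exact ⟨s, h2, by omega⟩
      · have := hs s h1
        refine ⟨s⁻¹, by rw [map_inv, h2, inv_inv], ?_⟩
        have h3 := Γ.zsup_inv s
        have h4 := Γ.zsup_inv s⁻¹
        rw [inv_inv] at h4
        omega
    refine ⟨s * g, by rw [map_mul, hsx, hg, List.prod_cons], ?_⟩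
    have h1 := Γ.zsup_mul s g
    have h2 := Γ.zinf_mul s g
    simp only [List.length_cons]
    push_cast
    linarith

theorem word_upper (m₀ : ℕ) (hm : 0 < m₀) [(Subgroup.zpowers (Γ.Δ ^ m₀)).Normal] (g : G) :
    ∃ l : List (G ⧸ Subgroup.zpowers (Γ.Δ ^ m₀)), (∀ x ∈ l, x ∈ Γ.gens m₀) ∧
      l.prod = QuotientGroup.mk' (Subgroup.zpowers (Γ.Δ ^ m₀)) g ∧
      (l.length : ℤ) ≤ Γ.zsup g - Γ.zinf g + m₀ := by
  have hle := Γ.zinf_le_zsup g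
  obtain ⟨n, hn⟩ := Int.eq_ofNat_of_zero_le (sub_nonneg.2 hle)
  set a := Γ.zinf g with ha
  obtain ⟨w, hw1, hw2, hw3⟩ := Γ.prod_simples n ((Γ.Δ ^ a)⁻¹ * g) (Γ.zinf_spec g).1 (by
    rw [← Γ.mul_le (Γ.Δ ^ a), ← zpow_add]
    have : a + n = Γ.zsup g := by omega
    rw [this]
    simpa using (Γ.zsup_spec g).1)
  obtain ⟨k, hk⟩ := Int.eq_ofNat_of_zero_le (Int.emod_nonneg a (b := m₀) (by omega))
  have hklt := Int.emod_lt_of_pos a (b := m₀) (by omega)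
  have hπ : QuotientGroup.mk' (Subgroup.zpowers (Γ.Δ ^ m₀)) (Γ.Δ ^ a) =
      QuotientGroup.mk' (Subgroup.zpowers (Γ.Δ ^ m₀)) (Γ.Δ ^ k) := by
    have h1 : Γ.Δ ^ a = Γ.Δ ^ k * Γ.Δ ^ (m₀ * (a / m₀)) := by
      rw [← zpow_natCast, ← zpow_add]
      congr 1
      have := Int.emod_add_mul_ediv a m₀
      omega
    rw [h1, Γ.mk_zpow]
  refine ⟨(List.replicate k Γ.Δ ++ w).map (QuotientGroup.mk' (Subgroup.zpowers (Γ.Δ ^ m₀))),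
    ?_, ?_, ?_⟩
  · intro x hx
    obtain ⟨s, hs, rfl⟩ := List.mem_map.1 hx
    left
    refine ⟨s, ?_, rfl⟩
    rcases List.mem_append.1 hs with h | h
    · rw [List.eq_of_mem_replicate h]; exact ⟨Γ.Δ_mem, Γ.le_refl _⟩
    · exact hw2 s h
  · rw [← map_list_prod, List.prod_append, List.prod_replicate, hw3, map_mul, ← hπ, ← map_mul,
      mul_inv_cancel_left]
  · simp only [List.length_map, List.length_append, List.length_replicate, hw1]
    push_cast
    omega

theorem wlen_bounds (m₀ : ℕ) (hm : 0 < m₀) [(Subgroup.zpowers (Γ.Δ ^ m₀)).Normal] (g : G) :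
    Γ.zsup g - Γ.zinf g ≤ wlen (Γ.gens m₀) (QuotientGroup.mk' (Subgroup.zpowers (Γ.Δ ^ m₀)) g) ∧
    (wlen (Γ.gens m₀) (QuotientGroup.mk' (Subgroup.zpowers (Γ.Δ ^ m₀)) g) : ℤ) ≤
      Γ.zsup g - Γ.zinf g + m₀ := by
  obtain ⟨l, hl1, hl2, hl3⟩ := Γ.word_upper m₀ hm g
  set T := {n : ℕ | ∃ l : List (G ⧸ Subgroup.zpowers (Γ.Δ ^ m₀)), l.length = n ∧
    (∀ x ∈ l, x ∈ Γ.gens m₀) ∧ l.prod = QuotientGroup.mk' (Subgroup.zpowers (Γ.Δ ^ m₀)) g} with hT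
  have hmem : l.length ∈ T := ⟨l, rfl, hl1, hl2⟩
  constructor
  · obtain ⟨l', h1, h2, h3⟩ : sInf T ∈ T := Nat.sInf_mem ⟨_, hmem⟩
    obtain ⟨g', hg', hlen⟩ := Γ.word_lower m₀ l' h2
    rw [h3] at hg'
    obtain ⟨j, hj⟩ := Γ.mk_eq m₀ hg'
    have a1 := Γ.zsup_mul g' (Γ.Δ ^ (m₀ * j))
    have a2 := Γ.zinf_mul g' (Γ.Δ ^ (m₀ * j))
    have a3 := Γ.zinf_zpow_ge (m₀ * j)
    have a4 := Γ.zsup_zpow_le (m₀ * j)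
    rw [← hj] at a1 a2
    change _ ≤ ((sInf T : ℕ) : ℤ)
    rw [← h1]
    linarith
  · have : wlen (Γ.gens m₀) (QuotientGroup.mk' (Subgroup.zpowers (Γ.Δ ^ m₀)) g) ≤ l.length :=
      Nat.sInf_le hmem
    have h2 : (wlen (Γ.gens m₀) (QuotientGroup.mk' (Subgroup.zpowers (Γ.Δ ^ m₀)) g) : ℤ) ≤
      l.length := by exact_mod_cast this
    linarith

theorem tendsto_wlen (m₀ : ℕ) (hm : 0 < m₀) [(Subgroup.zpowers (Γ.Δ ^ m₀)).Normal] (g : G) :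
    Filter.Tendsto (fun n : ℕ => (wlen (Γ.gens m₀)
      ((QuotientGroup.mk' (Subgroup.zpowers (Γ.Δ ^ m₀)) g) ^ n) : ℝ) / (n : ℝ))
      Filter.atTop (nhds (Γ.tsup g - Γ.tinf g)) := by
  have h1 := (Γ.tsup_spec g).sub (Γ.tinf_spec g)
  have h2 := h1.add (tendsto_const_div_atTop_nhds_zero_nat (m₀ : ℝ))
  rw [add_zero] at h2
  refine tendsto_of_tendsto_of_tendsto_of_le_of_le h1 h2 ?_ ?_
  · intro n
    have := (Γ.wlen_bounds m₀ hm (g ^ n)).1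
    rw [map_pow] at this
    simp only
    rw [← sub_div]
    gcongr
    exact_mod_cast this
  · intro n
    have := (Γ.wlen_bounds m₀ hm (g ^ n)).2
    rw [map_pow] at this
    simp only
    rw [← sub_div, ← add_div]
    gcongr
    exact_mod_cast this

end final

end GarsideGroup

/-- the quotient `G_Δ = G/⟨Δ^{m₀}⟩` of a Garside group is strongly
translation discrete, and its translation numbers w.r.t. `𝒟̄ ∪ 𝒟̄⁻¹` are rational of
the form `p/q` with `1 ≤ q ≤ N²`. -/
theorem statement4 {G : Type*} [Group G] (Γ : GarsideGroup G) (m₀ : ℕ)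
    (hm₀ : IsLeast {m : ℕ | 0 < m ∧ ∀ x : G, Commute (Γ.Δ ^ m) x} m₀)
    [(Subgroup.zpowers (Γ.Δ ^ m₀)).Normal] :
    (∀ q : G ⧸ Subgroup.zpowers (Γ.Δ ^ m₀), ¬ IsOfFinOrder q →
      ∃ t : ℝ, Filter.Tendsto
          (fun n : ℕ =>
            (wlen ((QuotientGroup.mk' (Subgroup.zpowers (Γ.Δ ^ m₀)) '' Γ.simples) ∪
                (QuotientGroup.mk' (Subgroup.zpowers (Γ.Δ ^ m₀)) '' Γ.simples)⁻¹)
              (q ^ n) : ℝ) / (n : ℝ))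
          Filter.atTop (nhds t) ∧ 0 < t) ∧
    (∀ r : ℝ,
      {c : ConjClasses (G ⧸ Subgroup.zpowers (Γ.Δ ^ m₀)) |
        ∃ q, c = ConjClasses.mk q ∧
          ∃ t : ℝ, Filter.Tendsto
              (fun n : ℕ =>
                (wlen ((QuotientGroup.mk' (Subgroup.zpowers (Γ.Δ ^ m₀)) '' Γ.simples) ∪
                    (QuotientGroup.mk' (Subgroup.zpowers (Γ.Δ ^ m₀)) '' Γ.simples)⁻¹)
                  (q ^ n) : ℝ) / (n : ℝ))
              Filter.atTop (nhds t) ∧ t ≤ r}.Finite) ∧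
    (∀ q : G ⧸ Subgroup.zpowers (Γ.Δ ^ m₀),
      ∃ p d : ℤ, 1 ≤ d ∧ d ≤ (Γ.norm Γ.Δ : ℤ) ^ 2 ∧
        Filter.Tendsto
          (fun n : ℕ =>
            (wlen ((QuotientGroup.mk' (Subgroup.zpowers (Γ.Δ ^ m₀)) '' Γ.simples) ∪
                (QuotientGroup.mk' (Subgroup.zpowers (Γ.Δ ^ m₀)) '' Γ.simples)⁻¹)
              (q ^ n) : ℝ) / (n : ℝ))
          Filter.atTop (nhds ((p : ℝ) / (d : ℝ)))) := by
  have hm : 0 < m₀ := hm₀.1.1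
  have hcen := hm₀.1.2
  refine ⟨?_, ?_, ?_⟩
  · intro q hq
    obtain ⟨g, rfl⟩ := QuotientGroup.mk'_surjective _ q
    refine ⟨_, Γ.tendsto_wlen m₀ hm g, ?_⟩
    have hle : Γ.tinf g ≤ Γ.tsup g := by
      refine le_of_tendsto_of_tendsto' (Γ.tinf_spec g) (Γ.tsup_spec g) ?_
      intro n
      gcongr
      exact Γ.zinf_le_zsup _
    rcases hle.lt_or_eq with h | h
    · linarith
    · exfalso
      apply hq
      obtain ⟨p, d, hd1, -, hd⟩ := Γ.tinf_rational g
      lift d to ℕ using by omega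
      have hd0 : 0 < d := by omega
      have hdr : (d : ℝ) ≠ 0 := by positivity
      have e1 : Γ.tinf (g ^ d) = p := by
        rw [Γ.tinf_pow _ _ hd0, hd]; push_cast; field_simp
      have e2 : Γ.tsup (g ^ d) = p := by
        rw [Γ.tsup_pow _ _ hd0, ← h, hd]; push_cast; field_simp
      obtain ⟨n, y, hn, hny⟩ := Γ.torsion_of (g ^ d) p e1 e2
      rw [isOfFinOrder_iff_pow_eq_one]
      refine ⟨d * n * m₀, by positivity, ?_⟩
      have e3 : (g ^ d) ^ n = y * Γ.Δ ^ (n * p) * y⁻¹ := by rw [← hny]; group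
      have e4 : g ^ (d * n * m₀) = 1 * Γ.Δ ^ (m₀ * (n * p)) := by
        rw [pow_mul, pow_mul, e3, conj_pow, ← zpow_natCast, ← zpow_mul, mul_comm ((n : ℤ) * p),
          zpow_mul, zpow_natCast]
        have := ((hcen y).zpow_left (n * p)).eq
        rw [← this]
        group
      rw [← map_pow, e4, Γ.mk_zpow, map_one]
  · intro r
    refine ((Γ.finite_interval' 0 (⌈r⌉ + 2 + m₀)).image (fun x => ConjClasses.mk
      (QuotientGroup.mk' (Subgroup.zpowers (Γ.Δ ^ m₀)) x))).subset ?_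
    rintro c ⟨q, rfl, t, ht, htr⟩
    obtain ⟨g, rfl⟩ := QuotientGroup.mk'_surjective _ q
    have hte := tendsto_nhds_unique ht (Γ.tendsto_wlen m₀ hm g)
    set a : ℤ := ⌈Γ.tinf g⌉ - 1 with ha
    set b : ℤ := ⌊Γ.tsup g⌋ + 1 with hb
    have ha1 : (a : ℝ) < Γ.tinf g := by
      rw [ha]; push_cast; linarith [Int.ceil_lt_add_one (Γ.tinf g)]
    have ha2 : Γ.tinf g ≤ a + 1 := by
      rw [ha]; push_cast; linarith [Int.le_ceil (Γ.tinf g)]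
    have hb1 : Γ.tsup g < b := by
      rw [hb]; push_cast; exact Int.lt_floor_add_one _
    have hb2 : (b : ℝ) ≤ Γ.tsup g + 1 := by
      rw [hb]; push_cast; linarith [Int.floor_le (Γ.tsup g)]
    have hba : b - a ≤ ⌈r⌉ + 2 := by
      have : ((b - a : ℤ) : ℝ) ≤ ((⌈r⌉ + 2 : ℤ) : ℝ) := by
        push_cast; linarith [Int.le_ceil r]
      exact_mod_cast this
    obtain ⟨y, hy1, hy2⟩ := Γ.exists_both' g a b ha1 hb1
    have hx1 : leL Γ.P (Γ.Δ ^ a) (y⁻¹ * g * y) := by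
      have := (Γ.mul_le y⁻¹).2 hy1
      simpa [mul_assoc] using this
    have hx2 : leL Γ.P (y⁻¹ * g * y) (Γ.Δ ^ b) := by
      have := (Γ.mul_le y⁻¹).2 hy2
      simpa [mul_assoc] using this
    have hmod := Int.emod_add_mul_ediv a m₀
    have hmod1 := Int.emod_nonneg a (b := m₀) (by omega)
    have hmod2 := Int.emod_lt_of_pos a (b := m₀) (by omega)
    refine ⟨y⁻¹ * g * y * Γ.Δ ^ (m₀ * (-(a / m₀))), ⟨?_, ?_⟩, ?_⟩
    · have := (Γ.mulΔ_le (m₀ * (-(a / m₀)))).2 hx1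
      rw [← zpow_add] at this
      exact Γ.le_trans (Γ.zpow_le (by rw [mul_neg]; omega)) this
    · have := (Γ.mulΔ_le (m₀ * (-(a / m₀)))).2 hx2
      rw [← zpow_add] at this
      exact Γ.le_trans this (Γ.zpow_le (by rw [mul_neg]; omega))
    · simp only
      rw [Γ.mk_zpow, ConjClasses.mk_eq_mk_iff_isConj, isConj_iff]
      refine ⟨QuotientGroup.mk' _ y, ?_⟩
      rw [← map_inv, ← map_mul, ← map_mul]
      congr 1
      group
  · intro q
    obtain ⟨g, rfl⟩ := QuotientGroup.mk'_surjective _ q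
    obtain ⟨p1, q1, h1, h2, h3⟩ := Γ.tinf_rational g
    obtain ⟨p2, q2, h4, h5, h6⟩ := Γ.tsup_rational g
    refine ⟨p2 * q1 - p1 * q2, q1 * q2, by nlinarith, by nlinarith, ?_⟩
    have := Γ.tendsto_wlen m₀ hm g
    have e : (((p2 * q1 - p1 * q2 : ℤ) : ℝ) / ((q1 * q2 : ℤ) : ℝ)) = Γ.tsup g - Γ.tinf g := by
      have hq1 : (q1 : ℝ) ≠ 0 := by
        have : q1 ≠ 0 := by omega
        exact_mod_cast this
      have hq2 : (q2 : ℝ) ≠ 0 := by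
        have : q2 ≠ 0 := by omega
        exact_mod_cast this
      rw [h3, h6]; push_cast; field_simp
    rw [e]
    exact this
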